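/- The k-subspace {r ∈ C⁺(V) : τ(r) + r ∈ k·1} of C⁺(V) is exactly the k-linear span of {1} ∪ {e_I : I ⊆ {1,…,N}, |I| ≡ 2 (mod 4)}. (This subspace is the Lie algebra of the group G with G(R) = {g ∈ C⁺(V)⊗R : τ(g)g ∈ Rˣ}.) -/

import Mathlib

open CliffordAlgebra

set_option synthInstance.maxHeartbeats 1000000
set_option maxHeartbeats 2000000

noncomputable section

variable (k : Type*) [Field k] (N : ℕ)

/-- The quadratic form `Q(x) = x₁² + ⋯ + x_N²` on `V = k^N`. -/
def Qk : QuadraticForm k (Fin N → k) :=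
  QuadraticMap.weightedSumSquares k (fun _ : Fin N => (1 : k))

/-- The standard basis vectors `eᵢ` of `V` inside the Clifford algebra `C(V)`. -/
def e (i : Fin N) : CliffordAlgebra (Qk k N) := ι (Qk k N) (Pi.single i 1)

/-- For `I = {i₁ < ⋯ < i_r}`, the ordered product `e_I := e_{i₁}⋯e_{i_r}`. -/
def eProd (I : Finset (Fin N)) : CliffordAlgebra (Qk k N) :=
  ((I.sort (· ≤ ·)).map (e k N)).prod

theorem e_sq (i : Fin N) : e k N i * e k N i = 1 := by
  unfold e
  have h : Qk k N (Pi.single i 1) = 1 := by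
    simp [Qk, QuadraticMap.weightedSumSquares_apply, Pi.single_apply]
  rw [ι_sq_scalar, h, map_one]

theorem e_anti {i j : Fin N} (h : i ≠ j) : e k N i * e k N j = -(e k N j * e k N i) := by
  unfold e
  rw [eq_neg_iff_add_eq_zero, ι_mul_ι_add_swap]
  have : QuadraticMap.polar (Qk k N) (Pi.single i 1) (Pi.single j 1) = 0 := by
    simp only [QuadraticMap.polar, Qk, QuadraticMap.weightedSumSquares_apply, Pi.add_apply]
    rw [← Finset.sum_sub_distrib, ← Finset.sum_sub_distrib]
    apply Finset.sum_eq_zero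
    intro x _
    by_cases h1 : x = i
    · subst h1
      simp [h]
    · simp [h1]
  rw [this, map_zero]

theorem perm_prod {l₁ l₂ : List (Fin N)} (h : l₁.Perm l₂) (hn : l₁.Nodup) :
    (l₁.map (e k N)).prod = (l₂.map (e k N)).prod ∨
      (l₁.map (e k N)).prod = -(l₂.map (e k N)).prod := by
  induction h with
  | nil => simp
  | cons x _ ih =>
    rcases ih (List.nodup_cons.mp hn).2 with h | h <;> simp [h]
  | swap x y l =>
    right
    have hxy : y ≠ x := by
      rintro rfl
      simp at hn
    simp only [List.map_cons, List.prod_cons, ← mul_assoc]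
    rw [e_anti k N hxy, neg_mul]
  | trans h1 _ ih1 ih2 =>
    rcases ih1 hn with h | h <;> rcases ih2 (h1.nodup_iff.mp hn) with h' | h' <;> simp [h, h']

theorem e_mul_list (i : Fin N) (l : List (Fin N)) (h : i ∉ l) :
    (l.map (e k N)).prod * e k N i = (-1) ^ l.length * (e k N i * (l.map (e k N)).prod) := by
  induction l with
  | nil => simp
  | cons a l ih =>
    simp only [List.mem_cons, not_or] at h
    simp only [List.map_cons, List.prod_cons, List.length_cons]
    rw [mul_assoc, ih h.2, ← mul_assoc (e k N i), e_anti k N h.1, pow_succ]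
    rcases neg_one_pow_eq_or (CliffordAlgebra (Qk k N)) l.length with h | h <;>
      simp [h, mul_assoc]

theorem reverse_list (l : List (Fin N)) (h : l.Nodup) :
    reverse (Q := Qk k N) (l.map (e k N)).prod =
      (-1) ^ (l.length.choose 2) * (l.map (e k N)).prod := by
  induction l with
  | nil => simp
  | cons a l ih =>
    rw [List.nodup_cons] at h
    have ha : reverse (Q := Qk k N) (e k N a) = e k N a := by simp [e]
    simp only [List.map_cons, List.prod_cons, List.length_cons, reverse.map_mul]
    rw [ih h.2, ha, mul_assoc, e_mul_list k N a l h.1, Nat.choose_succ_succ, pow_add,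
      Nat.choose_one_right]
    simp only [← mul_assoc]
    rw [← pow_add, ← pow_add, add_comm]

theorem reverse_eProd (I : Finset (Fin N)) :
    reverse (Q := Qk k N) (eProd k N I) = (-1) ^ (I.card.choose 2) * eProd k N I := by
  unfold eProd
  rw [reverse_list k N _ (Finset.sort_nodup _ _), Finset.length_sort]

theorem reverse_eProd_zero (I : Finset (Fin N)) (h : I.card % 4 = 0) :
    reverse (Q := Qk k N) (eProd k N I) = eProd k N I := by
  rw [reverse_eProd, Even.neg_one_pow, one_mul]
  obtain ⟨m, hm⟩ : ∃ m, I.card = 4 * m := ⟨I.card / 4, by omega⟩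
  rw [hm, Nat.choose_two_right]
  have : 4 * m * (4 * m - 1) = 2 * (2 * (m * (4 * m - 1))) := by ring
  rw [this, Nat.mul_div_cancel_left _ (by norm_num)]
  exact even_two_mul _

theorem reverse_eProd_two (I : Finset (Fin N)) (h : I.card % 4 = 2) :
    reverse (Q := Qk k N) (eProd k N I) = -eProd k N I := by
  rw [reverse_eProd, Odd.neg_one_pow, neg_one_mul]
  obtain ⟨m, hm⟩ : ∃ m, I.card = 4 * m + 2 := ⟨I.card / 4, by omega⟩
  rw [hm, Nat.choose_two_right]
  have : (4 * m + 2) * (4 * m + 2 - 1) = 2 * (2 * (4 * m * m + 3 * m) + 1) := by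
    rw [show 4 * m + 2 - 1 = 4 * m + 1 by omega]
    ring
  rw [this, Nat.mul_div_cancel_left _ (by norm_num)]
  exact odd_two_mul_add_one _

theorem e_mul_eProd (i : Fin N) (I : Finset (Fin N)) :
    ∃ J : Finset (Fin N), (J.card = I.card + 1 ∨ J.card + 1 = I.card) ∧
      (e k N i * eProd k N I = eProd k N J ∨ e k N i * eProd k N I = -eProd k N J) := by
  have key : ∀ K : Finset (Fin N), i ∉ K →
      (e k N i * eProd k N K = eProd k N (insert i K) ∨
        e k N i * eProd k N K = -eProd k N (insert i K)) := by
    intro K hK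
    have hn : (i :: K.sort (· ≤ ·)).Nodup := by
      simp [hK]
    have hp : (i :: K.sort (· ≤ ·)).Perm ((insert i K).sort (· ≤ ·)) := by
      rw [List.perm_ext_iff_of_nodup hn (Finset.sort_nodup _ _)]
      simp
    simpa [eProd] using perm_prod k N hp hn
  by_cases hi : i ∈ I
  · refine ⟨I.erase i, Or.inr (Finset.card_erase_add_one hi), ?_⟩
    have := key (I.erase i) (Finset.notMem_erase i I)
    rw [Finset.insert_erase hi] at this
    rcases this with h | h
    · left
      rw [← h, ← mul_assoc, e_sq, one_mul]
    · right
      rw [← neg_eq_iff_eq_neg] at h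
      rw [← h, mul_neg, ← mul_assoc, e_sq, one_mul]
  · exact ⟨insert i I, Or.inl (Finset.card_insert_of_notMem hi), key I hi⟩

/-- The span of the `e_I` with `|I| ≡ p (mod 2)`. -/
def parSpan (p : ℕ) : Submodule k (CliffordAlgebra (Qk k N)) :=
  Submodule.span k {x | ∃ I : Finset (Fin N), I.card % 2 = p % 2 ∧ x = eProd k N I}

theorem ι_mul_parSpan (p : ℕ) (m : Fin N → k) (x : CliffordAlgebra (Qk k N))
    (hx : x ∈ parSpan k N p) : ι (Qk k N) m * x ∈ parSpan k N (p + 1) := by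
  have hm : ι (Qk k N) m = ∑ i, m i • e k N i := by
    conv_lhs => rw [pi_eq_sum_univ' m]
    simp only [map_sum, map_smul, e]
  rw [hm, Finset.sum_mul]
  refine Submodule.sum_mem _ fun i _ => ?_
  rw [smul_mul_assoc]
  refine Submodule.smul_mem _ _ ?_
  unfold parSpan at hx
  induction hx using Submodule.span_induction with
  | mem x h =>
    obtain ⟨I, hI, rfl⟩ := h
    obtain ⟨J, hJ, h⟩ := e_mul_eProd k N i I
    have hm : eProd k N J ∈ parSpan k N (p + 1) :=
      Submodule.subset_span ⟨J, by omega, rfl⟩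
    rcases h with h | h <;> rw [h]
    · exact hm
    · exact Submodule.neg_mem _ hm
  | zero => simp
  | add x y _ _ hx hy => rw [mul_add]; exact Submodule.add_mem _ hx hy
  | smul a x _ hx => rw [mul_smul_comm]; exact Submodule.smul_mem _ _ hx

theorem eProd_empty : eProd k N ∅ = 1 := by simp [eProd]

theorem even_le (x : CliffordAlgebra (Qk k N)) (hx : x ∈ even (Qk k N)) :
    x ∈ parSpan k N 0 := by
  have hx' : x ∈ evenOdd (Qk k N) 0 := hx
  clear hx
  induction x, hx' using CliffordAlgebra.even_induction with
  | algebraMap r =>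
    rw [Algebra.algebraMap_eq_smul_one, ← eProd_empty]
    exact Submodule.smul_mem _ _ (Submodule.subset_span ⟨∅, by simp, rfl⟩)
  | add x y hx hy ihx ihy => exact Submodule.add_mem _ ihx ihy
  | ι_mul_ι_mul m₁ m₂ x hx ih =>
    rw [mul_assoc]
    exact ι_mul_parSpan k N 1 _ _ (ι_mul_parSpan k N 0 _ _ ih)

theorem list_mem_even (l : List (Fin N)) :
    (l.map (e k N)).prod ∈ evenOdd (Qk k N) (l.length : ZMod 2) := by
  induction l with
  | nil => simpa using SetLike.GradedOne.one_mem (A := evenOdd (Qk k N))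
  | cons a l ih =>
    simp only [List.map_cons, List.prod_cons, List.length_cons, Nat.cast_add, Nat.cast_one]
    rw [add_comm]
    exact SetLike.GradedMul.mul_mem (ι_mem_evenOdd_one (Qk k N) _) ih

theorem eProd_mem_even (I : Finset (Fin N)) (h : I.card % 4 = 2) :
    eProd k N I ∈ even (Qk k N) := by
  have := list_mem_even k N (I.sort (· ≤ ·))
  rw [Finset.length_sort, (ZMod.natCast_eq_zero_iff _ 2).mpr (by omega)] at this
  exact this

theorem decomp (x : CliffordAlgebra (Qk k N)) (hx : x ∈ parSpan k N 0) :
    ∃ a b, x = a + b ∧ reverse (Q := Qk k N) a = a ∧ reverse (Q := Qk k N) b = -b ∧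
      b ∈ Submodule.span k {x : CliffordAlgebra (Qk k N) |
            ∃ I : Finset (Fin N), I.card % 4 = 2 ∧ x = eProd k N I} := by
  unfold parSpan at hx
  induction hx using Submodule.span_induction with
  | mem x h =>
    obtain ⟨I, hI, rfl⟩ := h
    by_cases h4 : I.card % 4 = 0
    · exact ⟨eProd k N I, 0, by simp, reverse_eProd_zero k N I h4, by simp, by simp⟩
    · have h2 : I.card % 4 = 2 := by omega
      exact ⟨0, eProd k N I, by simp, by simp, reverse_eProd_two k N I h2,
        Submodule.subset_span ⟨I, h2, rfl⟩⟩
  | zero => exact ⟨0, 0, by simp⟩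
  | add x y _ _ hx hy =>
    obtain ⟨a, b, rfl, ha, hb, hm⟩ := hx
    obtain ⟨a', b', rfl, ha', hb', hm'⟩ := hy
    exact ⟨a + a', b + b', by abel, by rw [map_add, ha, ha'],
      by rw [map_add, hb, hb']; abel, Submodule.add_mem _ hm hm'⟩
  | smul c x _ hx =>
    obtain ⟨a, b, rfl, ha, hb, hm⟩ := hx
    exact ⟨c • a, c • b, by rw [smul_add], by rw [map_smul, ha],
      by rw [map_smul, hb, smul_neg], Submodule.smul_mem _ _ hm⟩

/-- The subspace `{r ∈ C⁺(V) : τ(r) + r ∈ k·1}` (the Lie algebra of the group `G` with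
`G(R) = {g ∈ C⁺(V)⊗R : τ(g)g ∈ Rˣ}`) is exactly the `k`-span of
`{1} ∪ {e_I : |I| ≡ 2 (mod 4)}`. -/
theorem statement6 [IsAlgClosed k] (hchar : (2 : k) ≠ 0) (hN : 2 ≤ N) :
    {r : CliffordAlgebra (Qk k N) | r ∈ even (Qk k N) ∧
        ∃ c : k, reverse (Q := Qk k N) r + r = algebraMap k (CliffordAlgebra (Qk k N)) c}
      = ↑(Submodule.span k (insert (1 : CliffordAlgebra (Qk k N))
          {x : CliffordAlgebra (Qk k N) |
            ∃ I : Finset (Fin N), I.card % 4 = 2 ∧ x = eProd k N I})) := by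
  ext r
  simp only [Set.mem_ofPred_eq, SetLike.mem_coe]
  constructor
  · rintro ⟨hr, c, hc⟩
    obtain ⟨a, b, rfl, ha, hb, hm⟩ := decomp k N r (even_le k N r hr)
    rw [map_add, ha, hb] at hc
    have h2 : (2 : k) • a = c • (1 : CliffordAlgebra (Qk k N)) := by
      rw [← Algebra.algebraMap_eq_smul_one, ← hc, two_smul]
      abel
    have h3 : a = ((2 : k)⁻¹ * c) • (1 : CliffordAlgebra (Qk k N)) := by
      rw [mul_smul, ← h2, smul_smul, inv_mul_cancel₀ hchar, one_smul]
    refine Submodule.add_mem _ ?_ (Submodule.span_mono (Set.subset_insert _ _) hm)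
    rw [h3]
    exact Submodule.smul_mem _ _ (Submodule.subset_span (Set.mem_insert _ _))
  · intro hr
    induction hr using Submodule.span_induction with
    | mem x h =>
      rcases h with rfl | ⟨I, hI, rfl⟩
      · exact ⟨one_mem _, 2, by rw [reverse.map_one, one_add_one_eq_two, map_ofNat]⟩
      · exact ⟨eProd_mem_even k N I hI, 0, by rw [reverse_eProd_two k N I hI]; simp⟩
    | zero => exact ⟨zero_mem _, 0, by simp⟩
    | add x y _ _ hx hy =>
      obtain ⟨hx, c, hc⟩ := hx
      obtain ⟨hy, d, hd⟩ := hy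
      refine ⟨add_mem hx hy, c + d, ?_⟩
      rw [map_add, map_add, ← hc, ← hd]
      abel
    | smul a x _ hx =>
      obtain ⟨hx, c, hc⟩ := hx
      refine ⟨Subalgebra.smul_mem _ hx a, a * c, ?_⟩
      rw [map_smul, ← smul_add, hc, map_mul, Algebra.smul_def]
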